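/- arXiv:0812.3381 — 6 statements merged into one kernel-verified Lean document; each statement's English description precedes it below -/
import Mathlib

section
/- Let X be an ℝ^d-valued random vector, φ: ℝ^d → ℝ Borel, α ∈ (0,1). If φ(X) ∈ L¹ and the distribution function of φ(X) is continuous, then the function V(ξ) = E[ξ + (1/(1−α))(φ(X) − ξ)₊] is convex and differentiable on ℝ, with derivative V′(ξ) = 1 − (1/(1−α)) P(φ(X) > ξ) for every ξ ∈ ℝ; moreover V′(ξ) = E[1 − (1/(1−α)) 1_{φ(X) ≥ ξ}]. -/
open MeasureTheory Set

open Filter Topology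

/-- A real random variable with continuous distribution function has no atoms. -/
theorem measure_eq_zero_of_continuous_cdf {Ω : Type*} [MeasurableSpace Ω] {μ : Measure Ω}
    [IsFiniteMeasure μ] {Y : Ω → ℝ} (hY : Measurable Y)
    (hcdf : Continuous (fun ξ : ℝ => (μ {ω | Y ω ≤ ξ}).toReal)) (ξ : ℝ) :
    μ {ω | Y ω = ξ} = 0 := by
  have hle : ∀ x < ξ, μ.real {ω | Y ω = ξ} ≤ μ.real {ω | Y ω ≤ ξ} - μ.real {ω | Y ω ≤ x} := by
    intro x hx
    have hdisj : Disjoint {ω | Y ω = ξ} {ω | Y ω ≤ x} := by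
      rw [Set.disjoint_left]
      intro ω (h₁ : Y ω = ξ) (h₂ : Y ω ≤ x)
      linarith
    have hunion := measureReal_union (μ := μ) hdisj (measurableSet_le hY measurable_const)
    have hsub : {ω | Y ω = ξ} ∪ {ω | Y ω ≤ x} ⊆ {ω | Y ω ≤ ξ} := by
      rintro ω (h | h)
      · exact le_of_eq h
      · exact le_trans h hx.le
    have := measureReal_mono (μ := μ) hsub
    linarith
  have hlim : Tendsto (fun x => μ.real {ω | Y ω ≤ ξ} - μ.real {ω | Y ω ≤ x}) (𝓝[<] ξ) (𝓝 0) := by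
    have h : Continuous (fun x => μ.real {ω | Y ω ≤ ξ} - μ.real {ω | Y ω ≤ x}) :=
      continuous_const.sub hcdf
    have h' := h.tendsto ξ
    rw [sub_self] at h'
    exact h'.mono_left nhdsWithin_le_nhds
  have h0 : μ.real {ω | Y ω = ξ} ≤ 0 :=
    ge_of_tendsto hlim (eventually_nhdsWithin_of_forall hle)
  exact (measureReal_eq_zero_iff).1 (le_antisymm h0 measureReal_nonneg)

/-- Away from the kink `x = y`, the function `x ↦ x + c (y - x)₊` is differentiable. -/
theorem hasDerivAt_add_mul_max_sub (c : ℝ) {y ξ : ℝ} (h : y ≠ ξ) :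
    HasDerivAt (fun x => x + c * max (y - x) 0)
      (1 - c * (Ioi ξ).indicator (fun _ => (1 : ℝ)) y) ξ := by
  rcases lt_or_gt_of_ne h with h | h
  · have he : (fun x => x + c * max (y - x) 0) =ᶠ[𝓝 ξ] fun x => x := by
      filter_upwards [lt_mem_nhds h] with x hx
      rw [max_eq_right (by linarith), mul_zero, add_zero]
    rw [indicator_of_notMem (by simpa using h.le), mul_zero, sub_zero]
    exact (hasDerivAt_id' ξ).congr_of_eventuallyEq he
  · have he : (fun x => x + c * max (y - x) 0) =ᶠ[𝓝 ξ] fun x => x + c * (y - x) := by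
      filter_upwards [gt_mem_nhds h] with x hx
      rw [max_eq_left (by linarith)]
    rw [indicator_of_mem (by simpa using h)]
    refine HasDerivAt.congr_of_eventuallyEq ?_ he
    have hd := (hasDerivAt_id' ξ).add (((hasDerivAt_id' ξ).const_sub y).const_mul c)
    rwa [mul_neg, ← sub_eq_add_neg] at hd

theorem convexOn_add_mul_max_sub {c : ℝ} (hc : 0 ≤ c) (y : ℝ) :
    ConvexOn ℝ univ (fun x : ℝ => x + c * max (y - x) 0) := by
  have h₁ : ConvexOn ℝ univ (fun x : ℝ => y - x) :=
    (convexOn_const y convex_univ).sub (concaveOn_id convex_univ)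
  exact (convexOn_id convex_univ).add ((h₁.sup (convexOn_const 0 convex_univ)).smul hc)

theorem lipschitzWith_add_mul_max_sub (c y : ℝ) :
    LipschitzWith (1 + Real.nnabs c) (fun x : ℝ => x + c * max (y - x) 0) := by
  refine LipschitzWith.of_dist_le_mul fun a b => ?_
  have h : |max (y - a) 0 - max (y - b) 0| ≤ |a - b| := by
    refine (abs_max_sub_max_le_abs _ _ _).trans_eq ?_
    rw [sub_sub_sub_cancel_left, abs_sub_comm]
  simp only [Real.dist_eq, NNReal.coe_add, NNReal.coe_one, Real.coe_nnabs]
  calc |a + c * max (y - a) 0 - (b + c * max (y - b) 0)|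
      = |(a - b) + c * (max (y - a) 0 - max (y - b) 0)| := by congr 1; ring
    _ ≤ |a - b| + |c| * |max (y - a) 0 - max (y - b) 0| := by
      rw [← abs_mul]; exact abs_add_le _ _
    _ ≤ |a - b| + |c| * |a - b| := by gcongr
    _ = (1 + |c|) * |a - b| := by ring

theorem integral_one_sub_mul_indicator {Ω : Type*} [MeasurableSpace Ω] {μ : Measure Ω}
    [IsProbabilityMeasure μ] {Y : Ω → ℝ} (hY : Measurable Y) (c : ℝ) {s : Set ℝ}
    (hs : MeasurableSet s) :
    ∫ ω, (1 - c * s.indicator (fun _ => (1 : ℝ)) (Y ω)) ∂μ = 1 - c * μ.real (Y ⁻¹' s) := by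
  have he : (fun ω => s.indicator (fun _ => (1 : ℝ)) (Y ω))
      = (Y ⁻¹' s).indicator (fun _ => (1 : ℝ)) := rfl
  have hint : Integrable (fun ω => s.indicator (fun _ => (1 : ℝ)) (Y ω)) μ := by
    rw [he]; exact (integrable_const 1).indicator (hY hs)
  rw [integral_sub (integrable_const 1) (hint.const_mul c), integral_const_mul, he,
    integral_indicator_const _ (hY hs)]
  simp

/-- Rockafellar–Uryasev: the function `V(ξ) = E[ξ + (1-α)⁻¹ (φ(X)-ξ)₊]` is convex and
differentiable with derivative `V'(ξ) = 1 - (1-α)⁻¹ P(φ(X) > ξ)`, which is also equal to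
`E[1 - (1-α)⁻¹ 1_{φ(X) ≥ ξ}]`. -/
theorem stmt0 {d : ℕ} {Ω : Type*} [MeasurableSpace Ω] (ℙ : Measure Ω) [IsProbabilityMeasure ℙ]
    (X : Ω → (Fin d → ℝ)) (hX : Measurable X)
    (φ : (Fin d → ℝ) → ℝ) (hφ : Measurable φ)
    (α : ℝ) (hα : α ∈ Set.Ioo (0 : ℝ) 1)
    (hL1 : Integrable (fun ω => φ (X ω)) ℙ)
    (hcdf : Continuous (fun ξ : ℝ => (ℙ {ω | φ (X ω) ≤ ξ}).toReal))
    (V : ℝ → ℝ)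
    (hV : ∀ ξ : ℝ, V ξ = ∫ ω, (ξ + (1 - α)⁻¹ * max (φ (X ω) - ξ) 0) ∂ℙ) :
    ConvexOn ℝ Set.univ V ∧
    (∀ ξ : ℝ, HasDerivAt V (1 - (1 - α)⁻¹ * (ℙ {ω | φ (X ω) > ξ}).toReal) ξ) ∧
    (∀ ξ : ℝ,
      1 - (1 - α)⁻¹ * (ℙ {ω | φ (X ω) > ξ}).toReal
        = ∫ ω, (1 - (1 - α)⁻¹ *
            Set.indicator {y : ℝ | ξ ≤ y} (fun _ => (1 : ℝ)) (φ (X ω))) ∂ℙ) := by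
  have hY : Measurable (fun ω => φ (X ω)) := hφ.comp hX
  have hc : 0 ≤ (1 - α)⁻¹ := inv_nonneg.2 (sub_nonneg.2 hα.2.le)
  generalize (1 - α)⁻¹ = c at *
  have hne : ∀ ξ : ℝ, ∀ᵐ ω ∂ℙ, φ (X ω) ≠ ξ := fun ξ => by
    rw [ae_iff]
    simpa using measure_eq_zero_of_continuous_cdf hY hcdf ξ
  have hint : ∀ ξ : ℝ, Integrable (fun ω => ξ + c * max (φ (X ω) - ξ) 0) ℙ := fun ξ =>
    (integrable_const ξ).add ((hL1.sub (integrable_const ξ)).pos_part.const_mul c)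
  obtain rfl : V = fun ξ => ∫ ω, (ξ + c * max (φ (X ω) - ξ) 0) ∂ℙ := funext hV
  refine ⟨⟨convex_univ, fun x _ y _ a b ha hb hab => ?_⟩, fun ξ => ?_, fun ξ => ?_⟩
  · simp only [smul_eq_mul]
    rw [← integral_const_mul, ← integral_const_mul,
      ← integral_add ((hint x).const_mul a) ((hint y).const_mul b)]
    exact integral_mono (hint _) (((hint x).const_mul a).add ((hint y).const_mul b)) fun ω =>
      (convexOn_add_mul_max_sub hc (φ (X ω))).2 (mem_univ x) (mem_univ y) ha hb hab
  · have hder := (hasDerivAt_integral_of_dominated_loc_of_lip (μ := ℙ) (𝕜 := ℝ)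
      (F := fun ξ ω => ξ + c * max (φ (X ω) - ξ) 0)
      (F' := fun ω => 1 - c * (Ioi ξ).indicator (fun _ => (1 : ℝ)) (φ (X ω)))
      (bound := fun _ => ((1 + Real.nnabs c : NNReal) : ℝ)) (s := univ) (x₀ := ξ) univ_mem
      (Eventually.of_forall fun x => (hint x).aestronglyMeasurable) (hint ξ)
      (measurable_const.sub (((measurable_const.indicator measurableSet_Ioi).comp hY).const_mul
        c)).aestronglyMeasurable
      (Eventually.of_forall fun ω => by
        rw [Real.nnabs_of_nonneg (NNReal.coe_nonneg _), Real.toNNReal_coe]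
        exact (lipschitzWith_add_mul_max_sub c (φ (X ω))).lipschitzOnWith)
      (integrable_const _)
      ((hne ξ).mono fun ω h => hasDerivAt_add_mul_max_sub c h)).2
    rwa [integral_one_sub_mul_indicator hY c measurableSet_Ioi] at hder
  · refine Eq.trans ?_ (integral_one_sub_mul_indicator hY c (measurableSet_Ici (a := ξ))).symm
    congr 2
    refine measureReal_congr ?_
    filter_upwards [hne ξ] with ω h
    exact propext ⟨fun h' => le_of_lt h', fun h' => lt_of_le_of_ne h' h.symm⟩
end

section
/- Let X be an ℝ^d-valued random vector, φ: ℝ^d → ℝ Borel, α ∈ (0,1). If φ(X) ∈ L¹ and the distribution function of φ(X) is continuous, then the set of minimizers of V coincides with {ξ ∈ ℝ : V′(ξ) = 0} = {ξ ∈ ℝ : P(φ(X) ≤ ξ) = α}; in particular VaR_α(φ(X)) := inf{ξ : P(φ(X) ≤ ξ) ≥ α} is a minimizer of V. -/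
open MeasureTheory Set

/-- A function on `ℝ` with a subgradient selection `g` that is continuous at `x` has derivative
`g x` at `x`. -/
theorem hasDerivAt_of_subgradient {f g : ℝ → ℝ} (h : ∀ x y, (y - x) * g x ≤ f y - f x) {x : ℝ}
    (hg : ContinuousAt g x) : HasDerivAt f (g x) x := by
  rw [hasDerivAt_iff_isLittleO, Asymptotics.isLittleO_iff]
  intro c hc
  filter_upwards [Metric.continuousAt_iff'.1 hg c hc] with y hy
  rw [Real.dist_eq] at hy
  have h1 := h x y
  have h2 := h y x
  have h3 : ‖f y - f x - (y - x) • g x‖ ≤ |y - x| * |g y - g x| := by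
    rw [← abs_mul, Real.norm_eq_abs, smul_eq_mul, abs_of_nonneg (by linarith)]
    refine le_trans ?_ (le_abs_self _)
    linarith
  refine h3.trans ?_
  rw [mul_comm, Real.norm_eq_abs]
  gcongr

/-- The pointwise subgradient inequality for `ξ ↦ (y - ξ)₊`. -/
theorem max_sub_zero_subgradient (y ξ η : ℝ) :
    max (y - ξ) 0 - (η - ξ) * (Ioi ξ).indicator 1 y ≤ max (y - η) 0 := by
  by_cases h : ξ < y
  · have : (Ioi ξ).indicator (1 : ℝ → ℝ) y = 1 := indicator_of_mem (mem_Ioi.2 h) _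
    rw [this, max_eq_left (by linarith)]
    exact le_trans (by linarith) (le_max_left _ _)
  · have : (Ioi ξ).indicator (1 : ℝ → ℝ) y = 0 := indicator_of_notMem (by simpa using h) _
    rw [this, max_eq_right (by linarith)]
    simp

/-- The subgradient inequality for the Rockafellar–Uryasev function of a random variable `Y`. -/
theorem integral_add_mul_max_subgradient {Ω : Type*} [MeasurableSpace Ω] {P : Measure Ω}
    [IsProbabilityMeasure P] {Y : Ω → ℝ} (hY : Measurable Y) (hint : Integrable Y P)
    {α : ℝ} (hα : α < 1) (ξ η : ℝ) :
    (η - ξ) * ((1 - α)⁻¹ * ((P {ω | Y ω ≤ ξ}).toReal - α)) ≤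
      (∫ ω, (η + (1 - α)⁻¹ * max (Y ω - η) 0) ∂P) -
        ∫ ω, (ξ + (1 - α)⁻¹ * max (Y ω - ξ) 0) ∂P := by
  have hα' : 0 < 1 - α := by linarith
  have hmax (t : ℝ) : Integrable (fun ω => max (Y ω - t) 0) P :=
    (hint.sub (integrable_const t)).pos_part
  have hs : MeasurableSet {ω | Y ω ≤ ξ} := measurableSet_le hY measurable_const
  have hs' : MeasurableSet {ω | ξ < Y ω} := measurableSet_lt measurable_const hY
  have hind : (fun ω => (Ioi ξ).indicator (1 : ℝ → ℝ) (Y ω)) = {ω | ξ < Y ω}.indicator 1 := by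
    ext ω
    simp [indicator_apply]
  have hindint : Integrable (fun ω => (Ioi ξ).indicator (1 : ℝ → ℝ) (Y ω)) P := by
    rw [hind]
    exact (integrable_const (1 : ℝ)).indicator hs'
  have hval : ∫ ω, (Ioi ξ).indicator (1 : ℝ → ℝ) (Y ω) ∂P = 1 - (P {ω | Y ω ≤ ξ}).toReal := by
    rw [hind, integral_indicator_one hs']
    have : {ω | ξ < Y ω} = {ω | Y ω ≤ ξ}ᶜ := by
      ext ω
      simp
    rw [this, probReal_compl_eq_one_sub hs]
    rfl
  have hsplit (t : ℝ) : ∫ ω, (t + (1 - α)⁻¹ * max (Y ω - t) 0) ∂P =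
      t + (1 - α)⁻¹ * ∫ ω, max (Y ω - t) 0 ∂P := by
    rw [integral_add (integrable_const t) ((hmax t).const_mul _), integral_const_mul]
    simp
  have hmono := integral_mono ((hmax ξ).sub (hindint.const_mul (η - ξ))) (hmax η)
    fun ω => max_sub_zero_subgradient (Y ω) ξ η
  simp only [Pi.sub_apply] at hmono
  rw [integral_sub (hmax ξ) (hindint.const_mul _), integral_const_mul, hval] at hmono
  rw [hsplit, hsplit]
  have h := mul_le_mul_of_nonneg_left hmono (inv_pos.2 hα').le
  have hinv : (1 - α)⁻¹ * (1 - α) = 1 := inv_mul_cancel₀ hα'.ne'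
  linear_combination h + (η - ξ) * hinv

/-- A continuous distribution function takes the value `α` at the lower `α`-quantile. -/
theorem measure_le_sInf_eq_of_continuous {Ω : Type*} [MeasurableSpace Ω] {P : Measure Ω}
    [IsProbabilityMeasure P] {Y : Ω → ℝ} (hY : Measurable Y)
    (hcdf : Continuous fun ξ : ℝ => (P {ω | Y ω ≤ ξ}).toReal) {α : ℝ} (hα : α ∈ Ioo (0 : ℝ) 1) :
    (P {ω | Y ω ≤ sInf {ξ : ℝ | α ≤ (P {ω | Y ω ≤ ξ}).toReal}}).toReal = α := by
  have : IsProbabilityMeasure (P.map Y) := Measure.isProbabilityMeasure_map hY.aemeasurable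
  have hF : (fun ξ : ℝ => (P {ω | Y ω ≤ ξ}).toReal) = ProbabilityTheory.cdf (P.map Y) := by
    ext ξ
    rw [ProbabilityTheory.cdf_eq_real, map_measureReal_apply hY measurableSet_Iic]
    rfl
  set F := fun ξ : ℝ => (P {ω | Y ω ≤ ξ}).toReal with hFdef
  change F (sInf {ξ | α ≤ F ξ}) = α
  have hbot : Filter.Tendsto F Filter.atBot (nhds 0) :=
    hF ▸ ProbabilityTheory.tendsto_cdf_atBot (P.map Y)
  have htop : Filter.Tendsto F Filter.atTop (nhds 1) :=
    hF ▸ ProbabilityTheory.tendsto_cdf_atTop (P.map Y)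
  have hmono : Monotone F := hF ▸ ProbabilityTheory.monotone_cdf (P.map Y)
  have hne : {ξ | α ≤ F ξ}.Nonempty :=
    ((htop.eventually (lt_mem_nhds hα.2)).exists).imp fun _ h => le_of_lt h
  obtain ⟨b, hb⟩ := (hbot.eventually (gt_mem_nhds hα.1)).exists
  have hbdd : BddBelow {ξ | α ≤ F ξ} :=
    ⟨b, fun ξ hξ => le_of_not_gt fun hlt => (hb.trans_le hξ).not_ge (hmono hlt.le)⟩
  refine le_antisymm ?_ ((isClosed_le continuous_const hcdf).csInf_mem hne hbdd)
  refine le_of_tendsto (hcdf.continuousWithinAt (s := Iio (sInf {ξ | α ≤ F ξ}))) ?_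
  filter_upwards [self_mem_nhdsWithin] with ξ hξ
  exact le_of_not_ge (fun h => notMem_of_lt_csInf hξ hbdd h)

open MeasureTheory Set

/-- The minimizers of `V(ξ) = E[ξ + (1-α)⁻¹(φ(X)-ξ)₊]` are exactly the zeros of `V'` and
exactly the `ξ` with `P(φ(X) ≤ ξ) = α`; in particular the Value-at-Risk
`VaR_α := inf {ξ | P(φ(X) ≤ ξ) ≥ α}` is a minimizer of `V`. -/
theorem stmt1 {d : ℕ} {Ω : Type*} [MeasurableSpace Ω] (ℙ : Measure Ω) [IsProbabilityMeasure ℙ]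
    (X : Ω → (Fin d → ℝ)) (hX : Measurable X)
    (φ : (Fin d → ℝ) → ℝ) (hφ : Measurable φ)
    (α : ℝ) (hα : α ∈ Set.Ioo (0 : ℝ) 1)
    (hL1 : Integrable (fun ω => φ (X ω)) ℙ)
    (hcdf : Continuous (fun ξ : ℝ => (ℙ {ω | φ (X ω) ≤ ξ}).toReal))
    (V : ℝ → ℝ)
    (hV : ∀ ξ : ℝ, V ξ = ∫ ω, (ξ + (1 - α)⁻¹ * max (φ (X ω) - ξ) 0) ∂ℙ) :
    {ξ : ℝ | IsMinOn V Set.univ ξ} = {ξ : ℝ | deriv V ξ = 0} ∧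
    {ξ : ℝ | deriv V ξ = 0} = {ξ : ℝ | (ℙ {ω | φ (X ω) ≤ ξ}).toReal = α} ∧
    IsMinOn V Set.univ (sInf {ξ : ℝ | α ≤ (ℙ {ω | φ (X ω) ≤ ξ}).toReal}) := by
  have hY : Measurable fun ω => φ (X ω) := hφ.comp hX
  have hα' : 0 < 1 - α := by linarith [hα.2]
  set F := fun ξ : ℝ => (ℙ {ω | φ (X ω) ≤ ξ}).toReal with hF
  have hsub (ξ η : ℝ) : (η - ξ) * ((1 - α)⁻¹ * (F ξ - α)) ≤ V η - V ξ := by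
    rw [hV, hV]
    exact integral_add_mul_max_subgradient hY hL1 hα.2 ξ η
  have hderiv (ξ : ℝ) : deriv V ξ = (1 - α)⁻¹ * (F ξ - α) :=
    (hasDerivAt_of_subgradient (g := fun ξ => (1 - α)⁻¹ * (F ξ - α)) hsub
      (continuous_const.mul (hcdf.sub continuous_const)).continuousAt).deriv
  have hzero (ξ : ℝ) : deriv V ξ = 0 ↔ F ξ = α := by
    rw [hderiv, mul_eq_zero, sub_eq_zero]
    exact or_iff_right (inv_pos.2 hα').ne'
  have hmin (ξ : ℝ) : IsMinOn V univ ξ ↔ deriv V ξ = 0 := by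
    refine ⟨fun h => (h.isLocalMin Filter.univ_mem).deriv_eq_zero, fun h η _ => ?_⟩
    have := hsub ξ η
    rw [← hderiv, h, mul_zero] at this
    exact sub_nonneg.1 this
  refine ⟨Set.ext hmin, Set.ext hzero, ?_⟩
  rw [hmin, hzero]
  exact measure_le_sInf_eq_of_continuous hY hcdf hα
end

section
/- Let X be an ℝ^d-valued random vector, φ: ℝ^d → ℝ Borel, α ∈ (0,1). If φ(X) ∈ L¹ and the distribution function of φ(X) is continuous, then for every ξ*_α with P(φ(X) ≤ ξ*_α) = α one has V(ξ*_α) = E[φ(X) | φ(X) > ξ*_α]; consequently min_{ξ∈ℝ} V(ξ) = CVaR_α(φ(X)). -/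
open MeasureTheory Set

section ContinuousCdf

open ProbabilityTheory Filter Topology

variable {Ω : Type*} [MeasurableSpace Ω] {μ : Measure Ω} [IsProbabilityMeasure μ] {Y : Ω → ℝ}

lemma toReal_measure_le_eq_cdf_map (hY : Measurable Y) (ξ : ℝ) :
    (μ {ω | Y ω ≤ ξ}).toReal = cdf (μ.map Y) ξ := by
  have := Measure.isProbabilityMeasure_map (μ := μ) hY.aemeasurable
  rw [cdf_eq_real, measureReal_def, Measure.map_apply hY measurableSet_Iic]
  rfl

lemma toReal_measure_lt_eq_one_sub (hY : Measurable Y) (ξ : ℝ) :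
    (μ {ω | ξ < Y ω}).toReal = 1 - (μ {ω | Y ω ≤ ξ}).toReal := by
  have h := probReal_compl_eq_one_sub (μ := μ) (measurableSet_le hY (measurable_const (a := ξ)))
  simpa only [compl_ofPred, not_le, measureReal_def] using h

lemma ae_ne_of_continuous_cdf (hY : Measurable Y)
    (hcdf : Continuous (fun ξ : ℝ => (μ {ω | Y ω ≤ ξ}).toReal)) (ξ : ℝ) :
    ∀ᵐ ω ∂μ, Y ω ≠ ξ := by
  have := Measure.isProbabilityMeasure_map (μ := μ) hY.aemeasurable
  simp only [toReal_measure_le_eq_cdf_map hY] at hcdf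
  have h : μ.map Y {ξ} = 0 := by
    rw [← measure_cdf (μ.map Y), StieltjesFunction.measure_singleton,
      (hcdf.continuousAt.continuousWithinAt).leftLim_eq]
    simp
  rw [Measure.map_apply hY (measurableSet_singleton ξ)] at h
  rw [ae_iff]
  simpa [preimage] using h

/-- The lower quantile of a random variable with continuous distribution function is attained. -/
lemma toReal_measure_le_sInf_eq (hY : Measurable Y)
    (hcdf : Continuous (fun ξ : ℝ => (μ {ω | Y ω ≤ ξ}).toReal))
    {α : ℝ} (hα : α ∈ Ioo (0 : ℝ) 1) :
    (μ {ω | Y ω ≤ sInf {ξ : ℝ | α ≤ (μ {ω | Y ω ≤ ξ}).toReal}}).toReal = α := by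
  simp only [toReal_measure_le_eq_cdf_map hY] at hcdf ⊢
  set F := cdf (μ.map Y)
  have hne : {ξ : ℝ | α ≤ F ξ}.Nonempty :=
    ((tendsto_cdf_atTop (μ.map Y)).eventually_const_le hα.2).exists
  obtain ⟨b, hb⟩ := ((tendsto_cdf_atBot (μ.map Y)).eventually_lt_const hα.1).exists
  have hbdd : BddBelow {ξ : ℝ | α ≤ F ξ} := by
    refine ⟨b, fun ξ hξ => ?_⟩
    by_contra! hlt
    exact absurd ((hξ.trans (F.mono hlt.le)).trans_lt hb) (lt_irrefl _)
  have hclosed : IsClosed {ξ : ℝ | α ≤ F ξ} := isClosed_le continuous_const hcdf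
  refine le_antisymm ?_ (hclosed.csInf_mem hne hbdd)
  refine le_of_tendsto (f := F) (x := 𝓝[<] sInf {ξ : ℝ | α ≤ F ξ}) hcdf.continuousWithinAt ?_
  filter_upwards [self_mem_nhdsWithin] with ξ hξ
  by_contra! hlt
  exact absurd (csInf_le hbdd (show ξ ∈ {ξ : ℝ | α ≤ F ξ} from hlt.le)) (not_le.2 hξ)

lemma integrable_add_mul_max_sub (hL1 : Integrable Y μ) (ξ c : ℝ) :
    Integrable (fun ω => ξ + c * max (Y ω - ξ) 0) μ :=
  (integrable_const ξ).add (((hL1.sub (integrable_const ξ)).pos_part).const_mul c)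

lemma integral_add_mul_indicator_sub (hY : Measurable Y) (hL1 : Integrable Y μ)
    {α : ℝ} (hα : α < 1) {ξs : ℝ} (hξs : (μ {ω | Y ω ≤ ξs}).toReal = α) (ξ : ℝ) :
    Integrable (fun ω => ξ + (1 - α)⁻¹ * {ω | ξs < Y ω}.indicator (fun ω => Y ω - ξ) ω) μ ∧
    ∫ ω, (ξ + (1 - α)⁻¹ * {ω | ξs < Y ω}.indicator (fun ω => Y ω - ξ) ω) ∂μ =
      (∫ ω in {ω | ξs < Y ω}, Y ω ∂μ) / (μ {ω | ξs < Y ω}).toReal := by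
  have hm : MeasurableSet {ω | ξs < Y ω} := measurableSet_lt measurable_const hY
  have hi : Integrable ({ω | ξs < Y ω}.indicator (fun ω => Y ω - ξ)) μ :=
    (hL1.sub (integrable_const ξ)).indicator hm
  refine ⟨(integrable_const ξ).add (hi.const_mul _), ?_⟩
  have hp := toReal_measure_lt_eq_one_sub (μ := μ) hY ξs
  rw [hξs] at hp
  rw [integral_add (integrable_const ξ) (hi.const_mul _), integral_const_mul,
    integral_indicator hm, integral_sub hL1.integrableOn (integrable_const ξ),
    setIntegral_const, measureReal_def, hp]
  have : 1 - α ≠ 0 := by linarith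
  simp
  field_simp
  ring

/-- The tail expectation above a level of probability `α` is the value at that level of the
Rockafellar–Uryasev functional. -/
lemma integral_add_mul_max_sub_eq (hY : Measurable Y) (hL1 : Integrable Y μ)
    {α : ℝ} (hα : α < 1) {ξs : ℝ} (hξs : (μ {ω | Y ω ≤ ξs}).toReal = α) :
    ∫ ω, (ξs + (1 - α)⁻¹ * max (Y ω - ξs) 0) ∂μ =
      (∫ ω in {ω | ξs < Y ω}, Y ω ∂μ) / (μ {ω | ξs < Y ω}).toReal := by
  rw [← (integral_add_mul_indicator_sub hY hL1 hα hξs ξs).2]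
  congr 1 with ω
  by_cases h : ξs < Y ω
  · simp [h, h.le]
  · simp [h, not_lt.1 h]

/-- The tail expectation above a level of probability `α` is a lower bound of the
Rockafellar–Uryasev functional. -/
lemma le_integral_add_mul_max_sub (hY : Measurable Y) (hL1 : Integrable Y μ)
    {α : ℝ} (hα : α < 1) {ξs : ℝ} (hξs : (μ {ω | Y ω ≤ ξs}).toReal = α) (ξ : ℝ) :
    (∫ ω in {ω | ξs < Y ω}, Y ω ∂μ) / (μ {ω | ξs < Y ω}).toReal ≤
      ∫ ω, (ξ + (1 - α)⁻¹ * max (Y ω - ξ) 0) ∂μ := by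
  obtain ⟨hi, he⟩ := integral_add_mul_indicator_sub hY hL1 hα hξs ξ
  rw [← he]
  refine integral_mono hi (integrable_add_mul_max_sub hL1 ξ _) fun ω => ?_
  have h1 : 0 ≤ (1 - α)⁻¹ := inv_nonneg.2 (by linarith)
  dsimp only
  gcongr
  by_cases h : ξs < Y ω
  · simp [h]
  · simp [h]

end ContinuousCdf

/-- For every `ξ*` with `P(φ(X) ≤ ξ*) = α` one has
`V(ξ*) = E[φ(X) | φ(X) > ξ*]`, and the minimum of `V` over ℝ equals
`CVaR_α(φ(X)) = E[φ(X) | φ(X) ≥ VaR_α(φ(X))]`. -/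
theorem stmt2 {d : ℕ} {Ω : Type*} [MeasurableSpace Ω] (ℙ : Measure Ω) [IsProbabilityMeasure ℙ]
    (X : Ω → (Fin d → ℝ)) (hX : Measurable X)
    (φ : (Fin d → ℝ) → ℝ) (hφ : Measurable φ)
    (α : ℝ) (hα : α ∈ Set.Ioo (0 : ℝ) 1)
    (hL1 : Integrable (fun ω => φ (X ω)) ℙ)
    (hcdf : Continuous (fun ξ : ℝ => (ℙ {ω | φ (X ω) ≤ ξ}).toReal))
    (V : ℝ → ℝ)
    (hV : ∀ ξ : ℝ, V ξ = ∫ ω, (ξ + (1 - α)⁻¹ * max (φ (X ω) - ξ) 0) ∂ℙ)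
    (VaR : ℝ)
    (hVaR : VaR = sInf {ξ : ℝ | α ≤ (ℙ {ω | φ (X ω) ≤ ξ}).toReal}) :
    (∀ ξs : ℝ, (ℙ {ω | φ (X ω) ≤ ξs}).toReal = α →
      V ξs = (∫ ω in {ω | ξs < φ (X ω)}, φ (X ω) ∂ℙ) / (ℙ {ω | ξs < φ (X ω)}).toReal) ∧
    IsLeast (Set.range V)
      ((∫ ω in {ω | VaR ≤ φ (X ω)}, φ (X ω) ∂ℙ) / (ℙ {ω | VaR ≤ φ (X ω)}).toReal) := by
  have hY : Measurable (fun ω => φ (X ω)) := hφ.comp hX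
  have hq := toReal_measure_le_sInf_eq hY hcdf hα
  rw [← hVaR] at hq
  have hset : {ω | VaR ≤ φ (X ω)} =ᵐ[ℙ] {ω | VaR < φ (X ω)} := by
    filter_upwards [ae_ne_of_continuous_cdf hY hcdf VaR] with ω hω
    exact propext ⟨fun h => lt_of_le_of_ne h hω.symm, le_of_lt⟩
  rw [setIntegral_congr_set hset, measure_congr hset]
  refine ⟨fun ξs hξs => ?_, ⟨VaR, ?_⟩, ?_⟩
  · rw [hV, integral_add_mul_max_sub_eq hY hL1 hα.2 hξs]
  · rw [hV, integral_add_mul_max_sub_eq hY hL1 hα.2 hq]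
  · rintro _ ⟨ξ, rfl⟩
    rw [hV]
    exact le_integral_add_mul_max_sub hY hL1 hα.2 hq ξ
end

section
/- Let X be an ℝ^d-valued random vector, φ: ℝ^d → ℝ Borel, α ∈ (0,1), and Ψ: ℝ → ℝ continuous with Ψ(φ(X)) ∈ L¹. If the distribution function of φ(X) is continuous, then for every ξ*_α with P(φ(X) ≤ ξ*_α) = α one has V_Ψ(ξ*_α) = E[Ψ(φ(X)) | φ(X) ≥ ξ*_α], where V_Ψ(ξ) := E[ξ + (1/(1−α))(Ψ(φ(X)) − ξ) 1_{φ(X) ≥ ξ}]. -/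
open MeasureTheory Set

/-- If the distribution function of `Y` is continuous, then `P(Y ≥ ξ) = 1 - P(Y ≤ ξ)`. -/
lemma measureReal_le_eq_one_sub_of_continuous_cdf {Ω : Type*} [MeasurableSpace Ω] (P : Measure Ω)
    [IsProbabilityMeasure P] {Y : Ω → ℝ} (hY : Measurable Y)
    (hcdf : Continuous (fun ξ : ℝ => P.real {ω | Y ω ≤ ξ})) (ξ : ℝ) :
    P.real {ω | ξ ≤ Y ω} = 1 - P.real {ω | Y ω ≤ ξ} := by
  have hlt : P.real {ω | Y ω < ξ} = P.real {ω | Y ω ≤ ξ} := by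
    refine le_antisymm (measureReal_mono fun ω (h : Y ω < ξ) => h.le) ?_
    refine le_of_tendsto ((hcdf.tendsto ξ).mono_left (nhdsWithin_le_nhds (s := Iio ξ))) ?_
    filter_upwards [self_mem_nhdsWithin] with η hη
    exact measureReal_mono fun ω (h : Y ω ≤ η) => h.trans_lt hη
  have hcompl : {ω | ξ ≤ Y ω} = {ω | Y ω < ξ}ᶜ := by
    ext ω
    simp
  rw [hcompl, probReal_compl_eq_one_sub (measurableSet_lt hY measurable_const), hlt]

/-- For every `ξ*` with `P(φ(X) ≤ ξ*) = α` one has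
`V_Ψ(ξ*) = E[Ψ(φ(X)) | φ(X) ≥ ξ*]`, where
`V_Ψ(ξ) = E[ξ + (1-α)⁻¹ (Ψ(φ(X)) - ξ) 1_{φ(X) ≥ ξ}]`. -/
theorem stmt3 {d : ℕ} {Ω : Type*} [MeasurableSpace Ω] (ℙ : Measure Ω) [IsProbabilityMeasure ℙ]
    (X : Ω → (Fin d → ℝ)) (hX : Measurable X)
    (φ : (Fin d → ℝ) → ℝ) (hφ : Measurable φ)
    (α : ℝ) (hα : α ∈ Set.Ioo (0 : ℝ) 1)
    (Ψ : ℝ → ℝ) (hΨ : Continuous Ψ)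
    (hL1 : Integrable (fun ω => Ψ (φ (X ω))) ℙ)
    (hcdf : Continuous (fun ξ : ℝ => (ℙ {ω | φ (X ω) ≤ ξ}).toReal))
    (VΨ : ℝ → ℝ)
    (hVΨ : ∀ ξ : ℝ, VΨ ξ = ∫ ω,
        (ξ + (1 - α)⁻¹ *
          Set.indicator {y : ℝ | ξ ≤ y} (fun y => Ψ y - ξ) (φ (X ω))) ∂ℙ) :
    ∀ ξs : ℝ, (ℙ {ω | φ (X ω) ≤ ξs}).toReal = α →
      VΨ ξs = (∫ ω in {ω | ξs ≤ φ (X ω)}, Ψ (φ (X ω)) ∂ℙ) /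
        (ℙ {ω | ξs ≤ φ (X ω)}).toReal := by
  intro ξs hξs
  have hY : Measurable fun ω => φ (X ω) := hφ.comp hX
  have hS : MeasurableSet {ω | ξs ≤ φ (X ω)} := measurableSet_le measurable_const hY
  have hP : ℙ.real {ω | ξs ≤ φ (X ω)} = 1 - α := by
    rw [← hξs]
    exact measureReal_le_eq_one_sub_of_continuous_cdf ℙ hY hcdf ξs
  have hind : (fun ω => indicator {y : ℝ | ξs ≤ y} (fun y => Ψ y - ξs) (φ (X ω))) =
      indicator {ω | ξs ≤ φ (X ω)} (fun ω => Ψ (φ (X ω)) - ξs) := rfl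
  have hint : Integrable (fun ω => Ψ (φ (X ω)) - ξs) ℙ := hL1.sub (integrable_const _)
  have hα' : 1 - α ≠ 0 := (sub_pos.2 hα.2).ne'
  have hindint : Integrable
      (fun ω => indicator {y : ℝ | ξs ≤ y} (fun y => Ψ y - ξs) (φ (X ω))) ℙ := by
    rw [hind]
    exact hint.indicator hS
  rw [hVΨ, integral_add (integrable_const _) (hindint.const_mul _), integral_const_mul, hind,
    integral_indicator hS, integral_sub hL1.integrableOn (integrable_const _),
    setIntegral_const, hP, ← measureReal_def, hP]
  simp only [integral_const, probReal_univ, smul_eq_mul]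
  field_simp
  ring
end

section
/- Let p: ℝ^d → (0, ∞) be a probability density, ρ > 0 and b ∈ [1,2] such that the function x ↦ log p(x) + ρ|x|^b is convex (assumption (B3)(ii)). Then for all x, θ ∈ ℝ^d: p(x)² / p(x−θ) ≤ e^{2ρ|θ|^b} p(x+θ). -/
open MeasureTheory

theorem norm_sub_rpow_add_norm_add_rpow_le {E : Type*} [NormedAddCommGroup E]
    [InnerProductSpace ℝ E] (x y : E) {b : ℝ} (hb₀ : 0 ≤ b) (hb₂ : b ≤ 2) :
    ‖x - y‖ ^ b + ‖x + y‖ ^ b ≤ 2 * ‖x‖ ^ b + 2 * ‖y‖ ^ b := by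
  have hpow (z : E) : (‖z‖ ^ 2) ^ (b / 2) = ‖z‖ ^ b := by
    rw [← Real.rpow_natCast_mul (norm_nonneg z)]
    congr 1
    push_cast
    ring
  have hconc := (Real.concaveOn_rpow (p := b / 2) (by linarith) (by linarith)).2
    (Set.mem_Ici.2 (sq_nonneg ‖x - y‖)) (Set.mem_Ici.2 (sq_nonneg ‖x + y‖))
    (by norm_num : (0 : ℝ) ≤ 1 / 2) (by norm_num : (0 : ℝ) ≤ 1 / 2) (by norm_num)
  have hmid : (1 / 2 : ℝ) • ‖x - y‖ ^ 2 + (1 / 2 : ℝ) • ‖x + y‖ ^ 2 = ‖x‖ ^ 2 + ‖y‖ ^ 2 := by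
    simp only [smul_eq_mul]
    linarith [parallelogram_law_with_norm ℝ x y]
  have hsub := Real.rpow_add_le_add_rpow (p := b / 2) (sq_nonneg ‖x‖) (sq_nonneg ‖y‖)
    (by linarith) (by linarith)
  rw [hmid] at hconc
  simp only [hpow, smul_eq_mul] at hconc hsub
  linarith

/-- If `p` is a positive probability density on `ℝ^d` such that
`x ↦ log p(x) + ρ|x|^b` is convex for some `ρ > 0` and `b ∈ [1,2]`, then
`p(x)²/p(x-θ) ≤ e^{2ρ|θ|^b} p(x+θ)` for all `x, θ`. -/
theorem stmt13 {d : ℕ} (p : EuclideanSpace ℝ (Fin d) → ℝ)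
    (hppos : ∀ x, 0 < p x) (hpmeas : Measurable p)
    (hpdens : ∫ x, p x = 1)
    (ρ b : ℝ) (hρ : 0 < ρ) (hb : b ∈ Set.Icc (1 : ℝ) 2)
    (hconv : ConvexOn ℝ Set.univ (fun x => Real.log (p x) + ρ * ‖x‖ ^ b)) :
    ∀ x θ : EuclideanSpace ℝ (Fin d),
      p x ^ 2 / p (x - θ) ≤ Real.exp (2 * ρ * ‖θ‖ ^ b) * p (x + θ) := by
  intro x θ
  have hmid : (1 / 2 : ℝ) • (x - θ) + (1 / 2 : ℝ) • (x + θ) = x := by module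
  have hc := hconv.2 (Set.mem_univ (x - θ)) (Set.mem_univ (x + θ))
    (by norm_num : (0 : ℝ) ≤ 1 / 2) (by norm_num : (0 : ℝ) ≤ 1 / 2) (by norm_num)
  simp only [hmid, smul_eq_mul] at hc
  have hn := mul_le_mul_of_nonneg_left
    (norm_sub_rpow_add_norm_add_rpow_le x θ (by linarith [hb.1]) hb.2) hρ.le
  have hx := hppos x
  have hsub := hppos (x - θ)
  have hadd := hppos (x + θ)
  rw [← Real.log_le_log_iff (by positivity) (by positivity), Real.log_div (by positivity)
    (by positivity), Real.log_mul (by positivity) (by positivity), Real.log_exp, Real.log_pow]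
  push_cast
  linarith
end

section
/- Let α ∈ (0,1), α̂ ∈ (0,1) with α̂ ≤ α, φ: ℝ^d → ℝ Borel. Define H₁(ξ,x) := 1 − (1/(1−α)) 1_{φ(x) ≥ ξ} and Ĥ₁(ξ,x,α̂) := 1 − (1/(1−α̂)) 1_{φ(x) ≥ ξ}. Then for every ξ ∈ ℝ and x ∈ ℝ^d, |Ĥ₁(ξ,x,α̂) − H₁(ξ,x)| ≤ |α̂ − α|/(1−α)². Consequently, if (α_n)_{n≥1} is a sequence in (0, α] and (γ_n) satisfies Σ_n γ_n (α − α_n)² < +∞, the remainder terms r_n := Ĥ₁(ξ̂_{n−1}, X_n, α_n) − H₁(ξ̂_{n−1}, X_n) of the moving-level VaR procedure satisfy Σ_n γ_n |r_n|² < +∞ almost surely. -/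
open MeasureTheory Filter Set

/-- Changing the level from `a` to `b`, with `a ≤ b < 1`, moves the update function
`a ↦ 1 - (1 - a)⁻¹ * t`, `t ∈ [0, 1]`, by at most `|a - b| / (1 - b) ^ 2`. -/
theorem abs_sub_level_le {a b t : ℝ} (hab : a ≤ b) (hb : b < 1) (ht0 : 0 ≤ t) (ht1 : t ≤ 1) :
    |(1 - (1 - a)⁻¹ * t) - (1 - (1 - b)⁻¹ * t)| ≤ |a - b| / (1 - b) ^ 2 := by
  have hb' : 0 < 1 - b := by linarith
  have ha' : 0 < 1 - a := by linarith
  have key : (1 - (1 - a)⁻¹ * t) - (1 - (1 - b)⁻¹ * t) = (b - a) / ((1 - a) * (1 - b)) * t := by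
    field_simp
    ring
  have hba : 0 ≤ b - a := by linarith
  rw [key, abs_of_nonneg (by positivity), abs_sub_comm, abs_of_nonneg hba]
  calc (b - a) / ((1 - a) * (1 - b)) * t
      ≤ (b - a) / ((1 - a) * (1 - b)) := mul_le_of_le_one_right (by positivity) ht1
    _ ≤ (b - a) / (1 - b) ^ 2 := by
        rw [sq]
        gcongr

/-- The indicator update functions at levels `a ≤ b < 1` differ by at most
`|a - b| / (1 - b) ^ 2`. -/
theorem abs_sub_level_indicator_le {a b : ℝ} (hab : a ≤ b) (hb : b < 1) (s : Set ℝ) (y : ℝ) :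
    |(1 - (1 - a)⁻¹ * s.indicator (fun _ => (1 : ℝ)) y) -
      (1 - (1 - b)⁻¹ * s.indicator (fun _ => (1 : ℝ)) y)| ≤ |a - b| / (1 - b) ^ 2 :=
  abs_sub_level_le hab hb (Set.indicator_nonneg (fun _ _ => zero_le_one) y)
    (Set.indicator_le_self' (fun _ _ => zero_le_one) y)

/-- The moving confidence level remainder bound: with
`H₁(ξ,x) = 1 - (1-α)⁻¹ 1_{φ(x) ≥ ξ}` and `Ĥ₁(ξ,x,α̂) = 1 - (1-α̂)⁻¹ 1_{φ(x) ≥ ξ}`,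
one has `|Ĥ₁(ξ,x,α̂) - H₁(ξ,x)| ≤ |α̂ - α|/(1-α)²` whenever `α̂ ≤ α`; consequently,
if `Σ_n γ_n (α - α_n)² < ∞` then the remainders
`r_n = Ĥ₁(ξ̂_{n-1}, X_n, α_n) - H₁(ξ̂_{n-1}, X_n)` satisfy `Σ_n γ_n |r_n|² < ∞` a.s. -/
theorem stmt18 {d : ℕ} {Ω : Type*} [MeasurableSpace Ω] (P : Measure Ω) [IsProbabilityMeasure P]
    (φ : (Fin d → ℝ) → ℝ)
    (α : ℝ) (hα : α ∈ Set.Ioo (0 : ℝ) 1) :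
    (∀ αhat : ℝ, αhat ∈ Set.Ioo (0 : ℝ) 1 → αhat ≤ α →
      ∀ (ξ : ℝ) (x : Fin d → ℝ),
        |(1 - (1 - αhat)⁻¹ * Set.indicator {y : ℝ | ξ ≤ y} (fun _ => (1 : ℝ)) (φ x)) -
         (1 - (1 - α)⁻¹ * Set.indicator {y : ℝ | ξ ≤ y} (fun _ => (1 : ℝ)) (φ x))|
          ≤ |αhat - α| / (1 - α) ^ 2) ∧
    (∀ (αseq : ℕ → ℝ), (∀ n, αseq n ∈ Set.Ioc (0 : ℝ) α) →
      ∀ (γ : ℕ → ℝ), (∀ n, 0 ≤ γ n) →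
      Summable (fun n => γ n * (α - αseq n) ^ 2) →
      ∀ (ξhat : ℕ → Ω → ℝ) (Xs : ℕ → Ω → (Fin d → ℝ))
        (r : ℕ → Ω → ℝ),
        (∀ n ω, 1 ≤ n → r n ω =
          (1 - (1 - αseq n)⁻¹ * Set.indicator {y : ℝ | ξhat (n - 1) ω ≤ y}
            (fun _ => (1 : ℝ)) (φ (Xs n ω))) -
          (1 - (1 - α)⁻¹ * Set.indicator {y : ℝ | ξhat (n - 1) ω ≤ y}
            (fun _ => (1 : ℝ)) (φ (Xs n ω)))) →
        ∀ᵐ ω ∂P, Summable (fun n => γ n * |r n ω| ^ 2)) := by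
  refine ⟨fun αhat _ hle ξ x => abs_sub_level_indicator_le hle hα.2 _ _, ?_⟩
  intro αseq hαseq γ hγ hsum ξhat Xs r hr
  refine ae_of_all P fun ω => ?_
  refine (summable_nat_add_iff 1).1 (Summable.of_nonneg_of_le
    (fun n => mul_nonneg (hγ _) (sq_nonneg _)) (fun n => ?_)
    (((summable_nat_add_iff 1).2 hsum).mul_right (((1 - α) ^ 2)⁻¹ ^ 2)))
  have hbound : |r (n + 1) ω| ≤ |αseq (n + 1) - α| / (1 - α) ^ 2 := by
    rw [hr (n + 1) ω (Nat.le_add_left 1 n)]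
    exact abs_sub_level_indicator_le (hαseq (n + 1)).2 hα.2 _ _
  calc γ (n + 1) * |r (n + 1) ω| ^ 2
      ≤ γ (n + 1) * (|αseq (n + 1) - α| / (1 - α) ^ 2) ^ 2 :=
        mul_le_mul_of_nonneg_left (pow_le_pow_left₀ (abs_nonneg _) hbound 2) (hγ _)
    _ = γ (n + 1) * (α - αseq (n + 1)) ^ 2 * ((1 - α) ^ 2)⁻¹ ^ 2 := by
        rw [div_eq_mul_inv, mul_pow, sq_abs]
        ring
end
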